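/- Let r ≥ 1 and let Γ be strongly regular with parameters ((r+2)², r(r+3), r² + 2r - 2, r² + r) (restricted eigenvalues r and s = -2, with k = r(3+r) and ℓ = 3+r; for r = 2 this is the complement of the Clebsch graph). Then the three matrices {A₀⊗A₀, A₁⊗A₀ + A₀⊗A₁ + A₂⊗A₂, J⊗J} span a fusion of the tensor square; that is, their ℝ-linear span is closed under matrix multiplication. (This is the rank-3 special case fusion with partition 249|35678 of Theorem 4.6(i), since the third fusion class J⊗J - A₀⊗A₀ - (A₁⊗A₀ + A₀⊗A₁ + A₂⊗A₂) has the same span together with the first two classes.) -/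

import Mathlib

open Matrix Kronecker

/-- The span of a set is closed under multiplication as soon as it contains all products of
two elements of the set. -/
theorem mul_mem_span_of_forall_mul_mem {R A : Type*} [CommSemiring R] [Semiring A] [Algebra R A]
    {S : Set A} (hS : ∀ x ∈ S, ∀ y ∈ S, x * y ∈ Submodule.span R S)
    {x y : A} (hx : x ∈ Submodule.span R S) (hy : y ∈ Submodule.span R S) :
    x * y ∈ Submodule.span R S := by
  have hxy := Submodule.mul_mem_mul hx hy
  rw [Submodule.span_mul_span] at hxy
  refine Submodule.span_le.2 ?_ hxy
  rintro _ ⟨a, ha, b, hb, rfl⟩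
  exact hS a ha b hb

theorem allOnes_kronecker_mul_self {V : Type*} [Fintype V] {J : Matrix V V ℝ} {r : ℝ}
    (hJJ : J * J = ((r + 2) ^ 2) • J) :
    (J ⊗ₖ J) * (J ⊗ₖ J) = ((r + 2) ^ 4) • (J ⊗ₖ J) := by
  rw [← mul_kronecker_mul, hJJ, smul_kronecker, kronecker_smul, smul_smul]
  ring_nf

section Fusion

variable {V : Type*} [Fintype V] [DecidableEq V] {A J : Matrix V V ℝ} {r : ℝ}

/-- The quadratic relation satisfied by the fused class `A₁ ⊗ A₀ + A₀ ⊗ A₁ + A₂ ⊗ A₂`. -/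
theorem fusedClass_mul_self
    (hAA : A * A = (2 * r) • (1 : Matrix V V ℝ) + (r - 2) • A + (r ^ 2 + r) • J)
    (hAJ : A * J = (r * (r + 3)) • J) (hJA : J * A = (r * (r + 3)) • J)
    (hJJ : J * J = ((r + 2) ^ 2) • J) :
    (A ⊗ₖ (1 : Matrix V V ℝ) + (1 : Matrix V V ℝ) ⊗ₖ A + (J - 1 - A) ⊗ₖ (J - 1 - A)) *
      (A ⊗ₖ (1 : Matrix V V ℝ) + (1 : Matrix V V ℝ) ⊗ₖ A + (J - 1 - A) ⊗ₖ (J - 1 - A)) =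
    (3 * ((r + 2) ^ 2 - 3)) • ((1 : Matrix V V ℝ) ⊗ₖ (1 : Matrix V V ℝ)) +
      ((r + 2) ^ 2 - 6) •
        (A ⊗ₖ (1 : Matrix V V ℝ) + (1 : Matrix V V ℝ) ⊗ₖ A + (J - 1 - A) ⊗ₖ (J - 1 - A)) +
      (6 : ℝ) • (J ⊗ₖ J) := by
  simp only [mul_add, add_mul, ← mul_kronecker_mul, mul_sub, sub_mul, mul_one, one_mul,
    hAA, hAJ, hJA, hJJ]
  ext ⟨i, i'⟩ ⟨j, j'⟩
  simp only [Matrix.add_apply, Matrix.sub_apply, Matrix.smul_apply, kroneckerMap_apply,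
    smul_eq_mul]
  ring

theorem fusedClass_mul_allOnes
    (hAJ : A * J = (r * (r + 3)) • J) (hJJ : J * J = ((r + 2) ^ 2) • J) :
    (A ⊗ₖ (1 : Matrix V V ℝ) + (1 : Matrix V V ℝ) ⊗ₖ A + (J - 1 - A) ⊗ₖ (J - 1 - A)) * (J ⊗ₖ J) =
      (3 * ((r + 2) ^ 2 - 1)) • (J ⊗ₖ J) := by
  simp only [add_mul, ← mul_kronecker_mul, sub_mul, one_mul, hAJ, hJJ]
  ext ⟨i, i'⟩ ⟨j, j'⟩
  simp only [Matrix.add_apply, Matrix.sub_apply, Matrix.smul_apply, kroneckerMap_apply,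
    smul_eq_mul]
  ring

theorem allOnes_mul_fusedClass
    (hJA : J * A = (r * (r + 3)) • J) (hJJ : J * J = ((r + 2) ^ 2) • J) :
    (J ⊗ₖ J) * (A ⊗ₖ (1 : Matrix V V ℝ) + (1 : Matrix V V ℝ) ⊗ₖ A + (J - 1 - A) ⊗ₖ (J - 1 - A)) =
      (3 * ((r + 2) ^ 2 - 1)) • (J ⊗ₖ J) := by
  simp only [mul_add, ← mul_kronecker_mul, mul_sub, mul_one, hJA, hJJ]
  ext ⟨i, i'⟩ ⟨j, j'⟩
  simp only [Matrix.add_apply, Matrix.sub_apply, Matrix.smul_apply, kroneckerMap_apply,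
    smul_eq_mul]
  ring

end Fusion

theorem clebsch_family_rank3_fusion {r : ℕ} (hr : 1 ≤ r)
    (Γ : SimpleGraph (Fin ((r + 2) ^ 2))) [DecidableRel Γ.Adj]
    (h : Γ.IsSRGWith ((r + 2) ^ 2) (r * (r + 3)) (r ^ 2 + 2 * r - 2) (r ^ 2 + r)) :
    let A₀ : Matrix (Fin ((r + 2) ^ 2)) (Fin ((r + 2) ^ 2)) ℝ := 1
    let A₁ : Matrix (Fin ((r + 2) ^ 2)) (Fin ((r + 2) ^ 2)) ℝ := Γ.adjMatrix ℝ
    let J : Matrix (Fin ((r + 2) ^ 2)) (Fin ((r + 2) ^ 2)) ℝ := Matrix.of fun _ _ => 1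
    let A₂ : Matrix (Fin ((r + 2) ^ 2)) (Fin ((r + 2) ^ 2)) ℝ := J - 1 - A₁
    let S : Set (Matrix (Fin ((r + 2) ^ 2) × Fin ((r + 2) ^ 2)) (Fin ((r + 2) ^ 2) × Fin ((r + 2) ^ 2)) ℝ) :=
      {A₀ ⊗ₖ A₀, A₁ ⊗ₖ A₀ + A₀ ⊗ₖ A₁ + A₂ ⊗ₖ A₂, J ⊗ₖ J}
    ∀ X ∈ Submodule.span ℝ S, ∀ Y ∈ Submodule.span ℝ S, X * Y ∈ Submodule.span ℝ S := by
  intro A₀ A₁ J A₂ S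
  have hJJ : J * J = (((r : ℝ) + 2) ^ 2) • J := by
    ext i j
    simp [J, Matrix.mul_apply]
  have hAJ : A₁ * J = ((r : ℝ) * (r + 3)) • J := by
    ext i j
    simp [J, A₁, SimpleGraph.adjMatrix_mul_apply, h.regular i]
  have hJA : J * A₁ = ((r : ℝ) * (r + 3)) • J := by
    ext i j
    simp [J, A₁, SimpleGraph.mul_adjMatrix_apply, h.regular j]
  have hAA : A₁ * A₁ = (2 * (r : ℝ)) • (1 : Matrix _ _ ℝ) + ((r : ℝ) - 2) • A₁ +
      ((r : ℝ) ^ 2 + r) • J := by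
    have hle : 2 ≤ r ^ 2 + 2 * r := by nlinarith
    rw [← pow_two, h.matrix_eq (α := ℝ)]
    simp only [← Nat.cast_smul_eq_nsmul ℝ]
    ext i j
    by_cases hij : i = j
    · subst hij
      simp [A₁, J]
      ring
    · by_cases ha : Γ.Adj i j <;>
        simp [A₁, J, SimpleGraph.adjMatrix_apply, hij, ha, Nat.cast_sub hle]
      ring
  have hI : A₀ ⊗ₖ A₀ = 1 := one_kronecker_one
  have h₀ : A₀ ⊗ₖ A₀ ∈ Submodule.span ℝ S := Submodule.subset_span (by simp [S])
  have h₁ : A₁ ⊗ₖ A₀ + A₀ ⊗ₖ A₁ + A₂ ⊗ₖ A₂ ∈ Submodule.span ℝ S :=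
    Submodule.subset_span (by simp [S])
  have h₂ : J ⊗ₖ J ∈ Submodule.span ℝ S := Submodule.subset_span (by simp [S])
  refine fun X hX Y hY => mul_mem_span_of_forall_mul_mem ?_ hX hY
  rintro x (rfl | rfl | rfl) y (rfl | rfl | rfl)
  · rwa [hI, one_mul, ← hI]
  · rwa [hI, one_mul]
  · rwa [hI, one_mul]
  · rwa [hI, mul_one]
  · rw [fusedClass_mul_self hAA hAJ hJA hJJ]
    exact add_mem (add_mem (Submodule.smul_mem _ _ h₀) (Submodule.smul_mem _ _ h₁))
      (Submodule.smul_mem _ _ h₂)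
  · rw [fusedClass_mul_allOnes hAJ hJJ]
    exact Submodule.smul_mem _ _ h₂
  · rwa [hI, mul_one]
  · rw [allOnes_mul_fusedClass hJA hJJ]
    exact Submodule.smul_mem _ _ h₂
  · rw [allOnes_kronecker_mul_self hJJ]
    exact Submodule.smul_mem _ _ h₂
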